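/- arXiv:2603.23336 — 3 statements merged into one kernel-verified Lean document; each statement's English description precedes it below -/
import Mathlib

section
/- Let μ : ℝ → ℝ be convex, nonincreasing and nonnegative, suppose the set {σ : μ(σ) = 0} is nonempty, and let ω = sInf {σ : μ(σ) = 0}. Assume the Kahane lower bound: μ(σ) ≥ ω − 1/2 − σ for all σ ∈ ℝ. Let σ₀ ∈ ℝ and s ∈ (0,1), and suppose −s is a global support slope of μ at σ₀, i.e. μ(σ) ≥ μ(σ₀) − s·(σ − σ₀) for all σ ∈ ℝ. Then μ(σ₀) ≤ s/(2(1−s)). -/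
/-- Slope–level constraint (Theorem: slope-level constraint).
If `μ` is a convex, nonincreasing, nonnegative order function, `ω` is the
infimum of its zero set, Kahane's lower bound `μ(σ) ≥ ω − 1/2 − σ` holds,
and `−s` (with `s ∈ (0,1)`) is a global support slope at `σ₀`, then
`μ(σ₀) ≤ s / (2(1−s))`. -/
theorem slope_level_constraint
    (μ : ℝ → ℝ)
    (hconv : ConvexOn ℝ Set.univ μ)
    (hmono : Antitone μ)
    (hnonneg : ∀ σ : ℝ, 0 ≤ μ σ)
    (hne : {σ : ℝ | μ σ = 0}.Nonempty)
    (ω : ℝ) (hω : ω = sInf {σ : ℝ | μ σ = 0})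
    (hkahane : ∀ σ : ℝ, ω - 1/2 - σ ≤ μ σ)
    (σ₀ s : ℝ) (hs : s ∈ Set.Ioo (0 : ℝ) 1)
    (hslope : ∀ σ : ℝ, μ σ₀ - s * (σ - σ₀) ≤ μ σ) :
    μ σ₀ ≤ s / (2 * (1 - s)) := by
  obtain ⟨hs0, hs1⟩ := hs
  have h1 : σ₀ + μ σ₀ / s ≤ ω := by
    rw [hω]
    refine le_csInf hne fun z hz => ?_
    have hz' : μ z = 0 := hz
    have h := hslope z
    have : μ σ₀ / s ≤ z - σ₀ := by
      rw [div_le_iff₀ hs0]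
      linarith
    linarith
  have h2 : μ σ₀ / s ≤ μ σ₀ + 1 / 2 := by
    have := hkahane σ₀
    linarith
  rw [div_le_iff₀ hs0] at h2
  rw [le_div_iff₀ (by linarith)]
  linarith
end

section
/- Assume the 'naive Sharp Kahane' hypothesis: for every a : ℕ → ℂ, every σ₀ ∈ ℝ with ∑_{n≥1} |a(n)|·n^{−σ₀} < ∞, every entire function L : ℂ → ℂ of order at most 1 (meaning: for every ε > 0 there is C > 0 with |L(z)| ≤ C·exp(|z|^{1+ε}) for all z ∈ ℂ) satisfying L(s) = ∑_{n≥1} a(n)·n^{−s} whenever Re(s) > σ₀, and all σ ∈ ℝ, β ≥ 0, the following holds: if for every ε > 0 there is K with |L(σ + it)| ≤ K·|t|^{β+ε} for all |t| ≥ 2, then for every ε > 0 there is K' with |L(σ + β + it)| ≤ K'·|t|^{ε} for all |t| ≥ 2. Then the Lindelöf Hypothesis holds for the Riemann zeta function: for every ε > 0 there is K with |ζ(1/2 + it)| ≤ K·|t|^{ε} for all |t| ≥ 2. -/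
open Complex in
theorem skl_zeta_norm_two : ∃ M : ℝ, ∀ s : ℂ, s.re = 2 → ‖riemannZeta s‖ ≤ M := by
  refine ⟨∑' n : ℕ, 1 / ((n:ℝ) + 1) ^ (2:ℝ), fun s hs => ?_⟩
  rw [zeta_eq_tsum_one_div_nat_add_one_cpow (by rw [hs]; norm_num)]
  have hs' : Summable fun n : ℕ => 1 / ((n:ℝ) + 1) ^ (2:ℝ) := by
    have := (summable_nat_add_iff 1).2 (Real.summable_one_div_nat_rpow.2 (by norm_num : (1:ℝ) < 2))
    simpa using this
  refine tsum_of_norm_bounded hs'.hasSum fun n => ?_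
  have : (n + 1 : ℂ) = ((n + 1 : ℝ) : ℂ) := by push_cast; rfl
  rw [this, norm_div, norm_one, norm_cpow_eq_rpow_re_of_pos (by positivity), hs]

open Complex in
theorem skl_Gamma_norm (s : ℂ) (hs : 0 < s.re) : ‖Gamma s‖ ≤ Real.Gamma s.re := by
  rw [Complex.Gamma_eq_integral hs, Real.Gamma_eq_integral hs, Complex.GammaIntegral]
  refine (MeasureTheory.norm_integral_le_integral_norm _).trans (le_of_eq ?_)
  refine MeasureTheory.setIntegral_congr_fun measurableSet_Ioi fun x hx => ?_
  have hx' : 0 < x := hx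
  simp only [norm_mul]
  rw [norm_cpow_eq_rpow_re_of_pos hx', norm_real, Real.norm_of_nonneg (Real.exp_pos _).le]
  simp

theorem skl_Gamma_real : ∃ M : ℝ, 0 < M ∧ ∀ x R : ℝ, 1/2 ≤ x → x ≤ R → 2 ≤ R →
    Real.Gamma x ≤ M * Real.exp (R * Real.log R) := by
  obtain ⟨M, hM⟩ := (isCompact_Icc (a := (1/2:ℝ)) (b := 2)).exists_bound_of_continuousOn
    (f := Real.Gamma) (fun x hx => (Real.differentiableAt_Gamma fun m => by
      have := hx.1
      have hm : (0:ℝ) ≤ m := Nat.cast_nonneg m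
      linarith).continuousAt.continuousWithinAt)
  refine ⟨|M| + 1, by positivity, fun x R hx hR h2 => ?_⟩
  have hlog : 0 ≤ R * Real.log R := mul_nonneg (by linarith) (Real.log_nonneg (by linarith))
  have he : 1 ≤ Real.exp (R * Real.log R) := Real.one_le_exp hlog
  rcases le_total x 2 with h | h
  · have h1 := (Real.le_norm_self _).trans (hM x ⟨hx, h⟩)
    have := le_abs_self M
    nlinarith [abs_nonneg M]
  · have h1 : Real.Gamma x ≤ Real.Gamma ((⌊x⌋₊ : ℝ) + 1) :=
      Real.Gamma_strictMonoOn_Ici.monotoneOn h (by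
        have := Nat.lt_floor_add_one x
        exact (h.trans this.le)) (Nat.lt_floor_add_one x).le
    rw [Real.Gamma_nat_eq_factorial] at h1
    have h3 : ((Nat.factorial ⌊x⌋₊ : ℕ) : ℝ) ≤ (⌊x⌋₊ : ℝ) ^ ⌊x⌋₊ := by
      exact_mod_cast Nat.factorial_le_pow _
    have h4 : (⌊x⌋₊ : ℝ) ≤ x := Nat.floor_le (by linarith)
    have h5 : (⌊x⌋₊ : ℝ) ^ ⌊x⌋₊ ≤ R ^ ⌊x⌋₊ := pow_le_pow_left₀ (by positivity) (by linarith) _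
    have h6 : R ^ ⌊x⌋₊ ≤ Real.exp (R * Real.log R) := by
      rw [← Real.rpow_natCast, Real.rpow_def_of_pos (by linarith), mul_comm]
      apply Real.exp_le_exp.2
      exact mul_le_mul_of_nonneg_right (by linarith) (Real.log_nonneg (by linarith))
    nlinarith [abs_nonneg M]

open Complex in
theorem skl_Gamma_line (t : ℝ) (ht : 2 ≤ |t|) :
    ‖Gamma (2 - t * I)‖ * ‖cos (Real.pi * (2 - t * I) / 2)‖ ≤ 4 * |t| ^ (3/2 : ℝ) := by
  have ht0 : t ≠ 0 := by rintro rfl; simp at ht; linarith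
  have hI : (t:ℂ) * I ≠ 0 := by simp [ht0]
  have h1 : ‖Gamma (1 - t * I)‖ ^ 2 * Real.sinh (Real.pi * |t|) = Real.pi * |t| := by
    have e1 := Complex.Gamma_mul_Gamma_one_sub (t * I)
    have e2 := Complex.Gamma_add_one (t * I) hI
    have e3 : Gamma (t * I + 1) = (starRingEnd ℂ) (Gamma (1 - t * I)) := by
      rw [← Complex.Gamma_conj]; congr 1; simp [add_comm]
    have e4 : ‖Gamma (t * I + 1)‖ = ‖Gamma (1 - t * I)‖ := by rw [e3, Complex.norm_conj]
    have e5 : sin (Real.pi * (t * I)) = Real.sinh (Real.pi * t) * I := by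
      rw [← mul_assoc, ← ofReal_mul, sin_mul_I, ofReal_sinh]
    have e6 : ‖sin (Real.pi * (t * I))‖ = Real.sinh (Real.pi * |t|) := by
      rw [e5, norm_mul, norm_I, mul_one, norm_real, Real.norm_eq_abs, Real.abs_sinh, abs_mul,
        abs_of_pos Real.pi_pos]
    have e7 : 0 < Real.sinh (Real.pi * |t|) := Real.sinh_pos_iff.2 (by positivity)
    have e8 := congrArg norm e1
    rw [norm_mul, norm_div, e6, norm_real, Real.norm_of_nonneg Real.pi_pos.le] at e8
    have e9 := congrArg norm e2
    rw [e4, norm_mul, norm_mul, norm_I, mul_one, norm_real, Real.norm_eq_abs] at e9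
    rw [eq_div_iff e7.ne'] at e8
    calc _ = |t| * (‖Gamma (t * I)‖ * ‖Gamma (1 - t * I)‖ * Real.sinh (Real.pi * |t|)) := by
          rw [pow_two]; nth_rewrite 1 [e9]; ring
      _ = _ := by rw [e8]; ring
  have h2 : ‖Gamma (2 - t * I)‖ ≤ 2 * |t| * ‖Gamma (1 - t * I)‖ := by
    have h0 : (1 - t * I : ℂ) ≠ 0 := fun h => by simpa using congrArg re h
    have := Complex.Gamma_add_one (1 - t * I) h0
    rw [show (2 - t * I : ℂ) = 1 - t * I + 1 by ring, this, norm_mul]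
    gcongr
    refine (norm_sub_le _ _).trans ?_
    simp; linarith
  have h3 : ‖cos (Real.pi * (2 - t * I) / 2)‖ = Real.cosh (Real.pi * |t| / 2) := by
    have : (Real.pi * (2 - t * I) / 2 : ℂ) = Real.pi - (Real.pi * t / 2 : ℝ) * I := by
      push_cast; ring
    rw [this, Complex.cos_pi_sub, norm_neg, cos_mul_I, ← ofReal_cosh, norm_real,
      Real.norm_of_nonneg (Real.cosh_pos _).le, ← Real.cosh_abs, abs_div, abs_mul,
      abs_of_pos Real.pi_pos]
    simp
  set x := Real.pi * |t| / 2 with hx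
  have hx1 : 1 ≤ x := by nlinarith [Real.pi_gt_three]
  have h4 : Real.cosh x ≤ 2 * Real.sinh x := by
    rw [Real.cosh_eq, Real.sinh_eq, Real.exp_neg]
    have := Real.add_one_le_exp x
    have h2e : 2 ≤ Real.exp x := by linarith
    have : (Real.exp x)⁻¹ ≤ 1/2 := by
      rw [inv_le_comm₀ (by positivity) (by norm_num)]; norm_num; exact h2e
    linarith
  have h5 : Real.sinh (Real.pi * |t|) = 2 * Real.sinh x * Real.cosh x := by
    rw [← Real.sinh_two_mul]; congr 1; rw [hx]; ring
  rw [h5] at h1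
  have hc := Real.cosh_pos x
  have h6 : (‖Gamma (1 - t * I)‖ * Real.cosh x) ^ 2 ≤ 4 * |t| := by
    have := mul_le_mul_of_nonneg_left h4
      (mul_nonneg (sq_nonneg ‖Gamma (1 - t * I)‖) hc.le)
    nlinarith [Real.pi_le_four, abs_nonneg t]
  have h7 : ‖Gamma (1 - t * I)‖ * Real.cosh x ≤ 2 * |t| ^ (1/2 : ℝ) := by
    refine abs_le_of_sq_le_sq' ?_ (by positivity) |>.2
    rw [mul_pow 2, ← Real.sqrt_eq_rpow, Real.sq_sqrt (abs_nonneg t)]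
    linarith
  rw [h3]
  calc _ ≤ 2 * |t| * ‖Gamma (1 - t * I)‖ * Real.cosh x := by gcongr
    _ = 2 * |t| * (‖Gamma (1 - t * I)‖ * Real.cosh x) := by ring
    _ ≤ 2 * |t| * (2 * |t| ^ (1/2 : ℝ)) := by gcongr
    _ = 4 * |t| ^ (3/2:ℝ) := by
      rw [show (3/2:ℝ) = 1 + 1/2 by norm_num, Real.rpow_add (by positivity), Real.rpow_one]; ring
open Complex Filter Topology MeasureTheory Set

noncomputable def sklF : ℝ → ℂ := Set.indicator (Set.Ioi 1) (fun t => ((t - ⌊t⌋₊ : ℝ) : ℂ))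

theorem sklF_norm (t : ℝ) : ‖sklF t‖ ≤ 1 := by
  unfold sklF
  by_cases h : t ∈ Set.Ioi (1:ℝ)
  · rw [Set.indicator_of_mem h, norm_real, Real.norm_eq_abs, abs_le]
    have h0 : (0:ℝ) ≤ t := le_trans zero_le_one (le_of_lt h)
    have := Nat.floor_le h0
    have := Nat.lt_floor_add_one t
    constructor <;> linarith
  · rw [Set.indicator_of_notMem h]; simp

theorem sklF_meas : Measurable sklF := by
  unfold sklF
  refine Measurable.indicator ?_ measurableSet_Ioi
  fun_prop

theorem skl_mellin_diff (s : ℂ) (hs : s.re < 0) : DifferentiableAt ℂ (mellin sklF) s := by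
  refine mellin_differentiableAt_of_isBigO_rpow (a := 0) (b := s.re - 1) ?_ ?_ hs ?_ (by linarith)
  · refine LocallyIntegrable.locallyIntegrableOn ?_ _
    refine (locallyIntegrable_const (1:ℝ)).mono sklF_meas.aestronglyMeasurable ?_
    exact Eventually.of_forall fun t => by simpa using sklF_norm t
  · refine Asymptotics.isBigO_of_le _ fun t => ?_
    simpa using sklF_norm t
  · refine (Asymptotics.isBigO_zero _ _).congr' ?_ EventuallyEq.rfl
    have : Set.Iio (1:ℝ) ∈ 𝓝[>] (0:ℝ) := mem_nhdsWithin_of_mem_nhds (Iio_mem_nhds one_pos)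
    filter_upwards [this] with t ht
    simp only [sklF]
    rw [Set.indicator_of_notMem]
    simpa using le_of_lt ht

theorem skl_mellin_eq (s : ℂ) : mellin sklF (-s) =
    ∫ t in Set.Ioi (1:ℝ), ((t - ⌊t⌋₊ : ℝ) : ℂ) * (t:ℂ) ^ (-(s + 1)) := by
  unfold mellin sklF
  have : ∀ t : ℝ, (t:ℂ) ^ (-s - 1) • Set.indicator (Set.Ioi 1) (fun t : ℝ => ((t - ⌊t⌋₊ : ℝ) : ℂ)) t
      = Set.indicator (Set.Ioi 1) (fun t : ℝ => ((t - ⌊t⌋₊ : ℝ) : ℂ) * (t:ℂ) ^ (-(s + 1))) t := by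
    intro t
    by_cases h : t ∈ Set.Ioi (1:ℝ)
    · rw [Set.indicator_of_mem h, Set.indicator_of_mem h, smul_eq_mul, mul_comm]
      congr 2; ring
    · rw [Set.indicator_of_notMem h, Set.indicator_of_notMem h]; simp
  simp_rw [this]
  rw [setIntegral_indicator measurableSet_Ioi]
  congr 2
  ext x; simp

theorem skl_int (s : ℂ) (hs : 0 < s.re) : IntegrableOn
    (fun t : ℝ => ((t - ⌊t⌋₊ : ℝ) : ℂ) * (t:ℂ) ^ (-(s + 1))) (Set.Ioi 1) := by
  have hg : IntegrableOn (fun t : ℝ => t ^ (-(s.re + 1))) (Set.Ioi 1) :=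
    integrableOn_Ioi_rpow_of_lt (by linarith) one_pos
  refine Integrable.mono' hg ?_ ?_
  · refine Measurable.aestronglyMeasurable ?_
    fun_prop
  · refine (ae_restrict_iff' measurableSet_Ioi).2 (Eventually.of_forall fun t ht => ?_)
    have ht' : (0:ℝ) < t := lt_trans one_pos ht
    have h1 := sklF_norm t
    rw [sklF, Set.indicator_of_mem ht] at h1
    rw [norm_mul, norm_cpow_eq_rpow_re_of_pos ht']
    have : (-(s+1)).re = -(s.re + 1) := by simp
    rw [this]
    exact mul_le_of_le_one_left (by positivity) h1

theorem skl_J_norm (s : ℂ) (hs : 0 < s.re) : ‖mellin sklF (-s)‖ ≤ 1 / s.re := by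
  rw [skl_mellin_eq]
  have hg : IntegrableOn (fun t : ℝ => t ^ (-(s.re + 1))) (Set.Ioi 1) :=
    integrableOn_Ioi_rpow_of_lt (by linarith) one_pos
  have hi : ∫ t in Set.Ioi (1:ℝ), t ^ (-(s.re + 1)) = 1 / s.re := by
    rw [integral_Ioi_rpow_of_lt (by linarith) one_pos]
    simp
  rw [← hi]
  refine norm_integral_le_of_norm_le hg ?_
  refine (ae_restrict_iff' measurableSet_Ioi).2 (Eventually.of_forall fun t ht => ?_)
  have ht' : (0:ℝ) < t := lt_trans one_pos ht
  have h1 := sklF_norm t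
  rw [sklF, Set.indicator_of_mem ht] at h1
  rw [norm_mul, norm_cpow_eq_rpow_re_of_pos ht']
  have : (-(s+1)).re = -(s.re + 1) := by simp
  rw [this]
  exact mul_le_of_le_one_left (by positivity) h1

theorem skl_zeta_one (s : ℂ) (hs : 1 < s.re) :
    riemannZeta₁ s = s - s * (s - 1) * mellin sklF (-s) := by
  have hs1 : s ≠ 1 := by rintro rfl; simp at hs
  have hL := LSeries_eq_mul_integral (fun _ => (1:ℂ)) (zero_le_one) (s := s) hs
    (LSeriesSummable_one_iff.2 hs) (by
      refine Asymptotics.isBigO_of_le _ fun n => ?_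
      simp)
  have hz : LSeries (fun _ => (1:ℂ)) s = riemannZeta s := LSeries_one_eq_riemannZeta hs
  rw [hz] at hL
  have h1 : ∫ t in Set.Ioi (1:ℝ), (∑ k ∈ Finset.Icc 1 ⌊t⌋₊, (1:ℂ)) * (t:ℂ) ^ (-(s + 1))
      = ∫ t in Set.Ioi (1:ℝ), ((t:ℂ) ^ (-s) -
        ((t - ⌊t⌋₊ : ℝ) : ℂ) * (t:ℂ) ^ (-(s + 1))) := by
    refine setIntegral_congr_fun measurableSet_Ioi fun t ht => ?_
    have ht' : (t:ℂ) ≠ 0 := by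
      have : (0:ℝ) < t := lt_trans one_pos ht
      exact_mod_cast this.ne'
    have : (t:ℂ) ^ (-s) = t * (t:ℂ) ^ (-(s+1)) := by
      rw [show -s = 1 + -(s+1) by ring, cpow_add _ _ ht', cpow_one]
    simp only [this]
    simp
    ring
  rw [h1, integral_sub (integrableOn_Ioi_cpow_of_lt (by simpa using hs) one_pos)
    (skl_int s (by linarith)), integral_Ioi_cpow_of_lt (by simpa using hs) one_pos,
    ← skl_mellin_eq] at hL
  have h2 := riemannZeta_eq_inv_sub_mul hs1
  have h3 : s - 1 ≠ 0 := sub_ne_zero.2 hs1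
  have h4 : riemannZeta₁ s = (s - 1) * riemannZeta s := by rw [h2]; field_simp
  rw [h4, hL]
  have h5 : -s + 1 ≠ 0 := fun h => h3 (by linear_combination -h)
  simp
  field_simp
  ring

theorem skl_zeta_half (s : ℂ) (hs : 0 < s.re) :
    riemannZeta₁ s = s - s * (s - 1) * mellin sklF (-s) := by
  have ho : IsOpen {s : ℂ | 0 < s.re} := isOpen_lt continuous_const continuous_re
  have hf : AnalyticOnNhd ℂ riemannZeta₁ {s : ℂ | 0 < s.re} :=
    differentiable_riemannZeta₁.differentiableOn.analyticOnNhd ho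
  have hg : AnalyticOnNhd ℂ (fun s => s - s * (s - 1) * mellin sklF (-s)) {s : ℂ | 0 < s.re} := by
    refine DifferentiableOn.analyticOnNhd (fun z hz => ?_) ho
    have hz' : 0 < z.re := hz
    have : DifferentiableAt ℂ (fun s => mellin sklF (-s)) z :=
      DifferentiableAt.fun_comp' (g := mellin sklF) (f := fun s => -s) z (skl_mellin_diff (-z) (by simpa using hz')) differentiableAt_id.neg
    exact (differentiableAt_id.sub ((differentiableAt_id.mul (differentiableAt_id.sub_const 1)).mul
      this)).differentiableWithinAt
  have hc : IsPreconnected {s : ℂ | 0 < s.re} := (convex_halfSpace_re_gt 0).isPreconnected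
  refine hf.eqOn_of_preconnected_of_eventuallyEq hg hc (z₀ := 2) (by simp) ?_ hs
  have : {s : ℂ | 1 < s.re} ∈ 𝓝 (2:ℂ) :=
    (isOpen_lt continuous_const continuous_re).mem_nhds (by simp)
  filter_upwards [this] with z hz using skl_zeta_one z hz

theorem skl_zeta_bound (s : ℂ) (hs : 1/2 ≤ s.re) (h1 : 1 ≤ ‖s - 1‖) :
    ‖riemannZeta s‖ ≤ 3 * ‖s‖ := by
  have hs1 : s ≠ 1 := by rintro rfl; simp at h1; linarith
  have h3 : s - 1 ≠ 0 := sub_ne_zero.2 hs1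
  have : riemannZeta s = s / (s - 1) - s * mellin sklF (-s) := by
    rw [riemannZeta_eq_inv_sub_mul hs1, skl_zeta_half s (by linarith)]; field_simp
  rw [this]
  refine (norm_sub_le _ _).trans ?_
  rw [norm_div, norm_mul]
  have hJ := skl_J_norm s (by linarith)
  have : 1 / s.re ≤ 2 := by rw [div_le_iff₀ (by linarith)]; linarith
  have h4 : ‖s‖ / ‖s - 1‖ ≤ ‖s‖ := div_le_self (norm_nonneg _) h1
  nlinarith [norm_nonneg s]
noncomputable def sklG (s : ℂ) : ℂ := 1 - (2:ℂ) ^ (1 - s)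

noncomputable def sklEta (s : ℂ) : ℂ := dslope sklG 1 s * riemannZeta₁ s

theorem sklG_diff : Differentiable ℂ sklG := by
  intro s
  unfold sklG
  refine DifferentiableAt.const_sub ?_ _
  exact (differentiableAt_id.const_sub 1).const_cpow (Or.inl two_ne_zero)

theorem sklEta_diff : Differentiable ℂ sklEta := by
  have h : Differentiable ℂ (dslope sklG 1) := by
    rw [← differentiableOn_univ, Complex.differentiableOn_dslope univ_mem]
    exact sklG_diff.differentiableOn
  exact h.mul differentiable_riemannZeta₁

theorem sklEta_eq (s : ℂ) (hs : s ≠ 1) : sklEta s = (1 - (2:ℂ) ^ (1 - s)) * riemannZeta s := by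
  rw [sklEta, dslope_of_ne _ hs, riemannZeta_eq_inv_sub_mul hs, slope_def_field]
  simp only [sklG]
  simp
  ring

theorem skl_pow_norm (w : ℂ) : ‖(2:ℂ) ^ w‖ = (2:ℝ) ^ w.re := by
  have := norm_cpow_eq_rpow_re_of_pos (two_pos : (0:ℝ) < 2) w
  simpa using this

theorem skl_right (z : ℂ) (hz : 1/2 ≤ z.re) (h2 : 2 ≤ ‖z‖) : ‖sklEta z‖ ≤ 9 * ‖z‖ := by
  have h1 : 1 ≤ ‖z - 1‖ := by
    have := norm_sub_norm_le z 1
    simp at this; linarith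
  have hz1 : z ≠ 1 := by rintro rfl; norm_num at h2
  rw [sklEta_eq z hz1, norm_mul]
  have h3 : ‖1 - (2:ℂ) ^ (1 - z)‖ ≤ 3 := by
    refine (norm_sub_le _ _).trans ?_
    rw [skl_pow_norm, norm_one]
    have : (2:ℝ) ^ (1 - z).re ≤ 2 ^ (1:ℝ) :=
      Real.rpow_le_rpow_of_exponent_le (by norm_num) (by simp; linarith)
    rw [Real.rpow_one] at this
    linarith
  have h4 := skl_zeta_bound z hz h1
  calc _ ≤ 3 * (3 * ‖z‖) := mul_le_mul h3 h4 (norm_nonneg _) (by norm_num)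
    _ = _ := by ring

theorem skl_norm_cos (w : ℂ) : ‖Complex.cos w‖ ≤ Real.exp ‖w‖ := by
  rw [Complex.cos, norm_div]
  have h1 : ‖cexp (w * I)‖ ≤ Real.exp ‖w‖ := by
    simpa using Complex.norm_exp_le_exp_norm (w * I)
  have h2 : ‖cexp (-w * I)‖ ≤ Real.exp ‖w‖ := by
    simpa using Complex.norm_exp_le_exp_norm (-w * I)
  have := norm_add_le (cexp (w * I)) (cexp (-w * I))
  simp only [Complex.norm_ofNat]
  linarith

theorem skl_eta_fe (s : ℂ) (hs : 0 < s.re) (h1 : s ≠ 1) : sklEta (1 - s) = (1 - (2:ℂ) ^ s) *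
    (2 * (2 * Real.pi) ^ (-s) * Gamma s * Complex.cos (Real.pi * s / 2) * riemannZeta s) := by
  have h0 : 1 - s ≠ 1 := fun h => by
    have : s = 0 := by linear_combination -h
    rw [this] at hs; simp at hs
  rw [sklEta_eq _ h0, riemannZeta_one_sub ?_ h1]
  · congr 3; ring
  · rintro n rfl
    simp at hs
    have : (0:ℝ) ≤ n := Nat.cast_nonneg n
    linarith

theorem skl_left : ∃ C : ℝ, 0 < C ∧ ∀ z : ℂ, z.re ≤ 1/2 → 2 ≤ ‖z‖ →
    ‖sklEta z‖ ≤ C * Real.exp (6 * ‖z‖ + 2 * ‖z‖ * Real.log (2 * ‖z‖)) := by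
  obtain ⟨M, hM, hG⟩ := skl_Gamma_real
  refine ⟨12 * M, by positivity, fun z hz h2 => ?_⟩
  obtain ⟨s, rfl⟩ : ∃ s, z = 1 - s := ⟨1 - z, by ring⟩
  have hs : 1/2 ≤ s.re := by simp at hz; linarith
  have hs1 : s ≠ 1 := by rintro rfl; simp at h2; linarith
  rw [skl_eta_fe s (by linarith) hs1]
  set r := ‖1 - s‖ with hr
  have hR : ‖s‖ ≤ 1 + r := by
    have := norm_sub_norm_le s 1
    rw [norm_sub_rev] at this; simp at this; linarith
  have hb : ‖riemannZeta s‖ ≤ 3 * ‖s‖ := skl_zeta_bound s hs (by rw [norm_sub_rev]; linarith)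
  have hg : ‖Gamma s‖ ≤ M * Real.exp (2 * r * Real.log (2 * r)) :=
    (skl_Gamma_norm s (by linarith)).trans
      (hG s.re (2 * r) hs ((Complex.re_le_norm s).trans (by linarith)) (by linarith))
  have hcos : ‖Complex.cos (Real.pi * s / 2)‖ ≤ Real.exp (4 * r) := by
    refine (skl_norm_cos _).trans (Real.exp_le_exp.2 ?_)
    rw [norm_div, norm_mul, norm_real, Real.norm_of_nonneg Real.pi_pos.le]
    simp only [Complex.norm_ofNat]
    have := mul_le_mul Real.pi_le_four hR (norm_nonneg s) (by norm_num)
    linarith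
  have hp : ‖1 - (2:ℂ) ^ s‖ * ‖(2 * Real.pi : ℂ) ^ (-s)‖ ≤ 2 := by
    have e1 : ‖(2 * Real.pi : ℂ) ^ (-s)‖ = ((2 * Real.pi : ℝ) ^ s.re)⁻¹ := by
      have := norm_cpow_eq_rpow_re_of_pos (x := 2 * Real.pi) (by positivity) (-s)
      rw [← Real.rpow_neg (by positivity)]
      simpa using this
    rw [e1, ← div_eq_mul_inv, div_le_iff₀ (by positivity)]
    have e2 : (1:ℝ) ≤ (2 * Real.pi) ^ s.re :=
      Real.one_le_rpow (by linarith [Real.pi_gt_three]) (by linarith)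
    have e3 : (2:ℝ) ^ s.re ≤ (2 * Real.pi) ^ s.re :=
      Real.rpow_le_rpow (by norm_num) (by linarith [Real.pi_gt_three]) (by linarith)
    refine (norm_sub_le _ _).trans ?_
    rw [skl_pow_norm, norm_one]; linarith
  have hs3 : ‖s‖ ≤ Real.exp (2 * r) := by
    have := Real.add_one_le_exp (2 * r)
    linarith
  rw [Real.exp_add, show 6 * r = 4 * r + 2 * r by ring, Real.exp_add]
  simp only [norm_mul, Complex.norm_ofNat]
  calc _ = 2 * (‖1 - (2:ℂ) ^ s‖ * ‖(2 * Real.pi : ℂ) ^ (-s)‖) * ‖Gamma s‖ *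
        ‖Complex.cos (Real.pi * s / 2)‖ * ‖riemannZeta s‖ := by ring
    _ ≤ 2 * 2 * (M * Real.exp (2 * r * Real.log (2 * r))) * Real.exp (4 * r) *
        (3 * Real.exp (2 * r)) := by
      have := hb.trans (mul_le_mul_of_nonneg_left hs3 (by norm_num : (0:ℝ) ≤ 3))
      gcongr
    _ = _ := by ring

theorem skl_order (ε : ℝ) (hε : 0 < ε) : ∃ C : ℝ, 0 < C ∧
    ∀ z : ℂ, ‖sklEta z‖ ≤ C * Real.exp (‖z‖ ^ (1 + ε)) := by
  obtain ⟨C, hC, hL⟩ := skl_left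
  have hev : ∀ᶠ r : ℝ in atTop, 6 * r + 2 * r * Real.log (2 * r) ≤ r ^ (1 + ε) := by
    have h1 := (isLittleO_log_rpow_atTop hε).bound (by norm_num : (0:ℝ) < 1/4)
    have h2 := (tendsto_rpow_atTop hε).eventually_ge_atTop (16:ℝ)
    filter_upwards [h1, h2, eventually_ge_atTop (1:ℝ)] with r h1 h2 h3
    have hr : 0 < r := by linarith
    rw [Real.norm_of_nonneg (Real.log_nonneg h3), Real.norm_of_nonneg (by positivity)] at h1
    rw [Real.log_mul two_ne_zero hr.ne', Real.rpow_add hr, Real.rpow_one]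
    have := Real.log_two_lt_d9
    have : 6 + 2 * (Real.log 2 + Real.log r) ≤ r ^ ε := by linarith
    nlinarith
  obtain ⟨R, hR⟩ := eventually_atTop.1 hev
  obtain ⟨M, hM⟩ := (isCompact_closedBall (0:ℂ) (max R 2)).exists_bound_of_continuousOn
    sklEta_diff.continuous.continuousOn
  refine ⟨C + |M| + 9, by positivity, fun z => ?_⟩
  set E := Real.exp (‖z‖ ^ (1 + ε))
  have hE : 1 ≤ E := Real.one_le_exp (by positivity)
  by_cases hz : ‖z‖ ≤ max R 2
  · have := hM z (by simpa using hz)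
    have := le_abs_self M
    nlinarith [abs_nonneg M]
  · have hz1 : R < ‖z‖ := (le_max_left _ _).trans_lt (not_le.1 hz)
    have hz2 : 2 < ‖z‖ := (le_max_right _ _).trans_lt (not_le.1 hz)
    have h1 : Real.exp (6 * ‖z‖ + 2 * ‖z‖ * Real.log (2 * ‖z‖)) ≤ E :=
      Real.exp_le_exp.2 (hR _ hz1.le)
    rcases le_total z.re (1/2) with h | h
    · have := hL z h hz2.le
      nlinarith [abs_nonneg M]
    · have h2 := skl_right z h hz2.le
      have h3 : ‖z‖ ≤ Real.exp (6 * ‖z‖ + 2 * ‖z‖ * Real.log (2 * ‖z‖)) := by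
        have h4 := Real.add_one_le_exp (6 * ‖z‖ + 2 * ‖z‖ * Real.log (2 * ‖z‖))
        have h5 : 0 ≤ Real.log (2 * ‖z‖) := Real.log_nonneg (by linarith)
        have h6 : 0 ≤ 2 * ‖z‖ * Real.log (2 * ‖z‖) := by positivity
        linarith
      nlinarith [abs_nonneg M]

theorem skl_line : ∃ K : ℝ, ∀ t : ℝ, 2 ≤ |t| →
    ‖sklEta (((-1 : ℝ) : ℂ) + t * I)‖ ≤ K * |t| ^ (3/2 : ℝ) := by
  obtain ⟨M, hM⟩ := skl_zeta_norm_two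
  refine ⟨40 * M, fun t ht => ?_⟩
  have hre : (2 - t * I : ℂ).re = 2 := by simp
  have h1 : (2 - t * I : ℂ) ≠ 1 := fun h => by
    have := congrArg re h
    rw [hre] at this; simp at this
  have := skl_eta_fe (2 - t * I) (by rw [hre]; norm_num) h1
  rw [show ((-1 : ℝ) : ℂ) + t * I = 1 - (2 - t * I) by push_cast; ring, this]
  have hz := hM _ hre
  have hG := skl_Gamma_line t ht
  have h2 : ‖1 - (2:ℂ) ^ (2 - t * I : ℂ)‖ ≤ 5 := by
    refine (norm_sub_le _ _).trans ?_
    rw [skl_pow_norm, norm_one, hre]; norm_num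
  have h3 : ‖(2 * Real.pi : ℂ) ^ (-(2 - t * I : ℂ))‖ ≤ 1 := by
    have := norm_cpow_eq_rpow_re_of_pos (x := 2 * Real.pi) (by positivity) (-(2 - t * I : ℂ))
    push_cast at this
    rw [this]
    refine Real.rpow_le_one_of_one_le_of_nonpos (by linarith [Real.pi_gt_three]) ?_
    rw [neg_re, hre]; norm_num
  rw [norm_mul, norm_mul, norm_mul, norm_mul, norm_mul, Complex.norm_ofNat]
  calc _ = 2 * ‖1 - (2:ℂ) ^ (2 - t * I : ℂ)‖ * ‖(2 * Real.pi : ℂ) ^ (-(2 - t * I : ℂ))‖ *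
        (‖Gamma (2 - t * I)‖ * ‖Complex.cos (Real.pi * (2 - t * I) / 2)‖) *
        ‖riemannZeta (2 - t * I)‖ := by ring
    _ ≤ 2 * 5 * 1 * (4 * |t| ^ (3/2 : ℝ)) * M := by gcongr
    _ = _ := by ring

theorem skl_series (s : ℂ) (hs : 1 < s.re) : sklEta s =
    ∑' n : ℕ, (if Even (n + 1) then (-1:ℂ) else 1) * ((n + 1 : ℕ) : ℂ) ^ (-s) := by
  have hs1 : s ≠ 1 := by rintro rfl; simp at hs
  have hsum : HasSum (fun n : ℕ => ((n + 1 : ℕ) : ℂ) ^ (-s)) (riemannZeta s) := by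
    rw [zeta_eq_tsum_one_div_nat_add_one_cpow hs]
    have : Summable (fun n : ℕ => ((n + 1 : ℕ) : ℂ) ^ (-s)) := by
      have := (summable_nat_add_iff 1).2 (Complex.summable_one_div_nat_cpow.2 hs)
      simpa [cpow_neg] using this
    convert this.hasSum using 3 with n
    push_cast
    rw [cpow_neg, one_div]
  have hinj : Function.Injective (fun k : ℕ => 2 * k + 1) := fun a b h => by
    simp at h; exact h
  have h2 : HasSum (fun n : ℕ => if Even (n + 1) then 2 * ((n + 1 : ℕ) : ℂ) ^ (-s) else 0)
      ((2:ℂ) ^ (1 - s) * riemannZeta s) := by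
    rw [← hinj.hasSum_iff]
    · have hm := hsum.mul_left ((2:ℂ) ^ (1 - s))
      refine Eq.mp (congrArg (fun f : ℕ → ℂ => HasSum f ((2:ℂ) ^ (1 - s) * riemannZeta s)) ?_) hm
      funext k
      symm
      have he : Even (2 * k + 1 + 1) := ⟨k + 1, by ring⟩
      simp only [Function.comp, he, if_true]
      rw [show 2 * k + 1 + 1 = 2 * (k + 1) by ring, Nat.cast_mul, natCast_mul_natCast_cpow,
        ← mul_assoc]
      congr 1
      rw [show (1 - s) = 1 + (-s) by ring, cpow_add _ _ two_ne_zero, cpow_one]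
      simp
    · intro x hx
      rw [if_neg]
      intro he
      obtain ⟨m, hm⟩ := he
      exact hx ⟨m - 1, by simp only; omega⟩
  rw [sklEta_eq s hs1]
  have := (hsum.sub h2).tsum_eq
  rw [sub_mul, one_mul, ← this]
  congr 1; ext n
  split_ifs <;> ring

theorem naive_sharp_kahane_implies_lindelof
    (H : ∀ (a : ℕ → ℂ) (σ₀ : ℝ),
      Summable (fun n : ℕ => ‖a (n + 1)‖ * ((n + 1 : ℝ)) ^ (-σ₀)) →
      ∀ L : ℂ → ℂ,
        (∀ ε : ℝ, 0 < ε → ∃ C : ℝ, 0 < C ∧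
          ∀ z : ℂ, ‖L z‖ ≤ C * Real.exp (‖z‖ ^ (1 + ε))) →
        Differentiable ℂ L →
        (∀ s : ℂ, σ₀ < s.re →
          L s = ∑' n : ℕ, a (n + 1) * ((n + 1 : ℕ) : ℂ) ^ (-s)) →
        ∀ (σ β : ℝ), 0 ≤ β →
          (∀ ε : ℝ, 0 < ε → ∃ K : ℝ, ∀ t : ℝ, 2 ≤ |t| →
            ‖L ((σ : ℂ) + t * Complex.I)‖ ≤ K * |t| ^ (β + ε)) →
          (∀ ε : ℝ, 0 < ε → ∃ K' : ℝ, ∀ t : ℝ, 2 ≤ |t| →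
            ‖L (((σ + β : ℝ) : ℂ) + t * Complex.I)‖ ≤ K' * |t| ^ ε)) :
    ∀ ε : ℝ, 0 < ε → ∃ K : ℝ, ∀ t : ℝ, 2 ≤ |t| →
      ‖riemannZeta (1 / 2 + t * Complex.I)‖ ≤ K * |t| ^ ε := by
  intro ε hε
  have hsm : Summable (fun n : ℕ => ‖(if Even (n + 1) then (-1:ℂ) else 1)‖ *
      ((n + 1 : ℝ)) ^ (-(2:ℝ))) := by
    have := (summable_nat_add_iff 1).2 (Real.summable_nat_rpow.2 (by norm_num : -(2:ℝ) < -1))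
    refine this.congr fun n => ?_
    have : ‖(if Even (n + 1) then (-1:ℂ) else 1)‖ = 1 := by split_ifs <;> simp
    rw [this, one_mul]; push_cast; rfl
  obtain ⟨K, hK⟩ := skl_line
  obtain ⟨K', hK'⟩ := H (fun n => if Even n then (-1:ℂ) else 1) 2 hsm sklEta skl_order sklEta_diff
    (fun s hs => skl_series s (by linarith)) (-1) (3/2) (by norm_num)
    (fun δ hδ => ⟨|K|, fun t ht => by
      refine (hK t ht).trans ?_
      have : |t| ^ (3/2 : ℝ) ≤ |t| ^ (3/2 + δ : ℝ) :=
        Real.rpow_le_rpow_of_exponent_le (by linarith) (by linarith)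
      have h0 : 0 ≤ |t| ^ (3/2 : ℝ) := by positivity
      exact mul_le_mul (le_abs_self K) this h0 (abs_nonneg K)⟩) ε hε
  refine ⟨4 * K', fun t ht => ?_⟩
  have h := hK' t ht
  have hs : (((-1 + 3/2 : ℝ) : ℂ) + t * I) = 1/2 + t * I := by push_cast; ring
  rw [hs] at h
  have hre : (1/2 + t * I : ℂ).re = 1/2 := by simp
  have hne : (1/2 + t * I : ℂ) ≠ 1 := fun h => by
    have := congrArg re h
    rw [hre] at this; norm_num at this
  rw [sklEta_eq _ hne, norm_mul] at h
  have hlow : 1/4 ≤ ‖1 - (2:ℂ) ^ (1 - (1/2 + t * I))‖ := by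
    have h1 := norm_sub_norm_le ((2:ℂ) ^ (1 - (1/2 + t * I))) 1
    rw [norm_sub_rev, skl_pow_norm, sub_re, hre, norm_one] at h1
    have h2 : (1:ℂ).re - 1/2 = 1/2 := by norm_num
    rw [h2, ← Real.sqrt_eq_rpow] at h1
    have h3 : (5/4 : ℝ) ≤ √2 := Real.le_sqrt_of_sq_le (by norm_num)
    linarith
  nlinarith [norm_nonneg (riemannZeta (1/2 + t * I))]
end

section
/- There exists an entire function L : ℂ → ℂ such that L(s) = ∑_{n≥1} â(n)·n^{−s} whenever Re(s) > 1, and L has order at most 1: for every ε > 0 there is C > 0 with |L(z)| ≤ C·exp(|z|^{1+ε}) for all z ∈ ℂ. -/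
open Complex Real

/-- `r(n) = ∏_{j=1}^∞ cos(3n/(4·3^j))`: the real cosine product giving the
Fourier coefficients of the ternary Cantor measure rescaled to `[0.5, 2.0]`. -/
noncomputable def cantorR (n : ℕ) : ℝ :=
  ∏' j : ℕ, Real.cos (3 * n / (4 * 3 ^ (j + 1)))

/-- `â(n) = e^{i(5/4)n} r(n)`: the Fourier coefficients of the rescaled ternary
Cantor measure. -/
noncomputable def cantorA (n : ℕ) : ℂ :=
  Complex.exp (Complex.I * (5 / 4) * n) * (cantorR n : ℂ)

/-- The Cantor Dirichlet series `∑_{n≥1} â(n) n^{-s}` (as a `tsum`). -/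
noncomputable def cantorSeries (s : ℂ) : ℂ :=
  ∑' n : ℕ, cantorA (n + 1) * ((n + 1 : ℕ) : ℂ) ^ (-s)

/-- `d = log 2 / log 3`, the Hausdorff dimension of the ternary Cantor set. -/
noncomputable def cantorDim : ℝ := Real.log 2 / Real.log 3


/-! ### Finite averages -/

noncomputable def cStep (j : ℕ) : ℝ := 3 / (4 * 3 ^ (j + 1))

noncomputable def cAvg : ℕ → (ℝ → ℂ) → ℝ → ℂ
  | 0, F, x => F x
  | N + 1, F, x => cAvg N (fun y => (F (y + cStep N) + F (y - cStep N)) / 2) x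

lemma cStep_nonneg (j : ℕ) : 0 ≤ cStep j := by unfold cStep; positivity

lemma sum_cStep (N : ℕ) : ∑ j ∈ Finset.range N, cStep j = 3 / 8 * (1 - 1 / 3 ^ N) := by
  induction N with
  | zero => simp
  | succ N ih =>
    rw [Finset.sum_range_succ, ih, cStep]
    field_simp
    ring

lemma cAvg_sub (N : ℕ) : ∀ (F G : ℝ → ℂ) (x : ℝ),
    cAvg N (fun y => F y - G y) x = cAvg N F x - cAvg N G x := by
  induction N with
  | zero => intro F G x; rfl
  | succ N ih =>
    intro F G x
    simp only [cAvg]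
    rw [← ih]
    congr 1
    funext y
    ring

lemma cAvg_const_mul (N : ℕ) : ∀ (c : ℂ) (F : ℝ → ℂ) (x : ℝ),
    cAvg N (fun y => c * F y) x = c * cAvg N F x := by
  induction N with
  | zero => intro c F x; rfl
  | succ N ih =>
    intro c F x
    simp only [cAvg]
    rw [← ih]
    congr 1
    funext y
    ring

lemma cAvg_bound (N : ℕ) : ∀ (F : ℝ → ℂ) (x B : ℝ),
    (∀ y, |y - x| ≤ ∑ j ∈ Finset.range N, cStep j → ‖F y‖ ≤ B) → ‖cAvg N F x‖ ≤ B := by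
  induction N with
  | zero => intro F x B h; exact h x (by simp)
  | succ N ih =>
    intro F x B h
    simp only [cAvg]
    apply ih
    intro y hy
    have h0 := cStep_nonneg N
    rw [Finset.sum_range_succ] at h
    rw [abs_le] at hy
    have h1 := h (y + cStep N) (by rw [abs_le]; constructor <;> linarith)
    have h2 := h (y - cStep N) (by rw [abs_le]; constructor <;> linarith)
    rw [norm_div, RCLike.norm_ofNat]
    have := norm_add_le (F (y + cStep N)) (F (y - cStep N))
    linarith

lemma cAvg_exp (n : ℕ) (N : ℕ) (x : ℝ) :
    cAvg N (fun y => Complex.exp (Complex.I * n * y)) x =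
      Complex.exp (Complex.I * n * x) *
        ((∏ j ∈ Finset.range N, Real.cos (3 * n / (4 * 3 ^ (j + 1))) : ℝ) : ℂ) := by
  induction N with
  | zero => simp [cAvg]
  | succ N ih =>
    simp only [cAvg]
    have : (fun y : ℝ => (Complex.exp (Complex.I * n * ((y + cStep N : ℝ) : ℂ)) +
        Complex.exp (Complex.I * n * ((y - cStep N : ℝ) : ℂ))) / 2) =
        fun y : ℝ => (Real.cos (3 * n / (4 * 3 ^ (N + 1))) : ℂ) *
          Complex.exp (Complex.I * n * y) := by
      funext y
      have e : (3 * n / (4 * 3 ^ (N + 1)) : ℝ) = n * cStep N := by unfold cStep; ring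
      rw [e, Complex.ofReal_cos, Complex.cos]
      push_cast
      have e1 : Complex.I * n * ((y : ℂ) + cStep N) =
        Complex.I * n * y + (n * cStep N) * Complex.I := by ring
      have e2 : Complex.I * n * ((y : ℂ) - cStep N) =
        Complex.I * n * y + -(n * cStep N) * Complex.I := by ring
      rw [e1, e2, Complex.exp_add, Complex.exp_add]
      ring
    rw [this, cAvg_const_mul, ih, Finset.prod_range_succ]
    push_cast
    ring

lemma cantorR_tendsto (n : ℕ) :
    Filter.Tendsto (fun N => ∏ j ∈ Finset.range N, Real.cos (3 * n / (4 * 3 ^ (j + 1))))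
      Filter.atTop (nhds (cantorR n)) := by
  have hm : Multipliable (fun j : ℕ => Real.cos (3 * n / (4 * 3 ^ (j + 1)))) := by
    have hs : Summable (fun j : ℕ => ‖Real.cos (3 * n / (4 * 3 ^ (j + 1))) - 1‖) := by
      have hg : Summable (fun j : ℕ => (n ^ 2 : ℝ) * (1 / 9 : ℝ) ^ j) :=
        (summable_geometric_of_lt_one (by norm_num) (by norm_num)).mul_left _
      refine Summable.of_nonneg_of_le (fun _ => norm_nonneg _) (fun j => ?_) hg
      have h1 := Real.one_sub_sq_div_two_le_cos (x := 3 * n / (4 * 3 ^ (j + 1)))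
      have h2 := Real.cos_le_one (3 * n / (4 * 3 ^ (j + 1)))
      rw [Real.norm_eq_abs, abs_le]
      have e : (3 * n / (4 * 3 ^ (j + 1)) : ℝ) ^ 2 = (n ^ 2 : ℝ) * (1 / 9 : ℝ) ^ j / 16 := by
        rw [div_pow, mul_pow, mul_pow, ← pow_mul, one_div, inv_pow,
          show (9 : ℝ) = 3 ^ 2 by norm_num, ← pow_mul]
        field_simp
        ring
      rw [e] at h1
      have : 0 ≤ (n ^ 2 : ℝ) * (1 / 9 : ℝ) ^ j := by positivity
      constructor <;> linarith
    have := multipliable_one_add_of_summable hs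
    simpa using this
  exact hm.hasProd.tendsto_prod_nat

noncomputable def cM : ℝ := 1 / (1 - Real.cos (1 / 2))

lemma cos_half_lt : Real.cos (1 / 2) < 1 := by
  have := Real.cos_lt_cos_of_nonneg_of_le_pi (x := 0) (y := 1 / 2) le_rfl
    (by linarith [Real.pi_gt_three]) (by norm_num)
  simpa using this

lemma one_le_cM : 1 ≤ cM := by
  unfold cM
  have h1 := cos_half_lt
  have h2 : 0 ≤ Real.cos (1 / 2) := Real.cos_nonneg_of_neg_pi_div_two_le_of_le
    (by linarith [Real.pi_gt_three]) (by linarith [Real.pi_gt_three])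
  rw [le_div_iff₀ (by linarith)]
  linarith

lemma weight_lower (x : ℝ) (h : |x - 5 / 4| ≤ 3 / 8) :
    1 - Real.cos (1 / 2) ≤ ‖Complex.exp (-(Complex.I * x)) - 1‖ := by
  rw [abs_le] at h
  have h1 : Real.cos x ≤ Real.cos (1 / 2) :=
    Real.cos_le_cos_of_nonneg_of_le_pi (by norm_num) (by linarith [Real.pi_gt_three])
      (by linarith)
  have h2 := Complex.abs_re_le_norm (Complex.exp (-(Complex.I * x)) - 1)
  have h3 : (Complex.exp (-(Complex.I * x)) - 1).re = Real.cos x - 1 := by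
    simp [Complex.exp_re]
  rw [h3] at h2
  have := neg_le_abs (Real.cos x - 1)
  linarith

lemma exists_coeffs : ∃ c : ℕ → ℕ → ℂ, (∀ n, c 0 n = cantorA n) ∧
    (∀ k n, c k (n + 1) = c (k + 1) n - c (k + 1) (n + 1)) ∧
    (∀ k n, ‖c k n‖ ≤ cM ^ k) := by
  let w : ℝ → ℂ := fun x => 1 / (Complex.exp (-(Complex.I * x)) - 1)
  let F : ℕ → ℕ → ℝ → ℂ := fun k n x => Complex.exp (Complex.I * n * x) * w x ^ k
  let cN : ℕ → ℕ → ℕ → ℂ := fun k n N => cAvg N (F k n) (5 / 4)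
  have hpos : 0 < 1 - Real.cos (1 / 2) := by linarith [cos_half_lt]
  have hsum : ∀ N, ∑ j ∈ Finset.range N, cStep j ≤ 3 / 8 := by
    intro N
    rw [sum_cStep]
    have : (0 : ℝ) ≤ 1 / 3 ^ N := by positivity
    linarith
  have hb : ∀ k n N, ‖cN k n N‖ ≤ cM ^ k := by
    intro k n N
    apply cAvg_bound
    intro y hy
    have hl := weight_lower y (hy.trans (hsum N))
    have h1 : ‖Complex.exp (Complex.I * n * y)‖ = 1 := by
      rw [Complex.norm_exp]; simp
    simp only [F, w, norm_mul, h1, one_mul, norm_pow, norm_div, norm_one]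
    unfold cM
    gcongr
  have hrel : ∀ k n N, cN k (n + 1) N = cN (k + 1) n N - cN (k + 1) (n + 1) N := by
    intro k n N
    simp only [cN]
    rw [← cAvg_sub, ← sub_eq_zero, ← cAvg_sub, ← norm_le_zero_iff]
    apply cAvg_bound
    intro y hy
    have hl := weight_lower y (hy.trans (hsum N))
    have hne : Complex.exp (-(Complex.I * y)) - 1 ≠ 0 := by
      rw [← norm_pos_iff]; linarith
    rw [norm_le_zero_iff]
    have e : Complex.exp (Complex.I * n * y) =
        Complex.exp (Complex.I * (n + 1 : ℕ) * y) * Complex.exp (-(Complex.I * y)) := by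
      rw [← Complex.exp_add]; congr 1; push_cast; ring
    simp only [F, w]
    rw [e]
    have hw : (1 / (Complex.exp (-(Complex.I * y)) - 1)) *
      (Complex.exp (-(Complex.I * y)) - 1) = 1 := by field_simp
    rw [pow_succ]
    linear_combination (-Complex.exp (Complex.I * (n + 1 : ℕ) * y) *
      (1 / (Complex.exp (-(Complex.I * y)) - 1)) ^ k) * hw
  have hlim : ∀ k n, ∃ l : ℂ, Filter.Tendsto (cN k n) (Filter.hyperfilter ℕ : Filter ℕ) (nhds l) := by
    intro k n
    obtain ⟨l, -, hl⟩ := (isCompact_closedBall (0 : ℂ) (cM ^ k)).ultrafilter_le_nhds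
      ((Filter.hyperfilter ℕ).map (cN k n)) (by
        rw [Filter.le_principal_iff]
        exact Filter.univ_mem' (s := cN k n ⁻¹' Metric.closedBall 0 (cM ^ k))
          (fun N => by simpa using hb k n N))
    exact ⟨l, hl⟩
  choose c hc using hlim
  refine ⟨c, fun n => ?_, fun k n => ?_, fun k n => ?_⟩
  · refine tendsto_nhds_unique (hc 0 n) ?_
    have h1 : cN 0 n = fun N => Complex.exp (Complex.I * (5 / 4) * n) *
      ((∏ j ∈ Finset.range N, Real.cos (3 * n / (4 * 3 ^ (j + 1))) : ℝ) : ℂ) := by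
      funext N
      simp only [cN, F, pow_zero, mul_one]
      rw [cAvg_exp]
      congr 2
      push_cast
      ring
    rw [h1, cantorA]
    have h2 := (Complex.continuous_ofReal.tendsto _).comp (cantorR_tendsto n)
    have h3 := h2.const_mul (Complex.exp (Complex.I * (5 / 4) * n))
    exact h3.mono_left (Nat.hyperfilter_le_atTop)
  · refine tendsto_nhds_unique (hc k (n + 1)) ?_
    rw [show cN k (n + 1) = _ from funext (hrel k n)]
    exact (hc _ _).sub (hc _ _)
  · exact le_of_tendsto (hc k n).norm (Filter.Eventually.of_forall (hb k n))

/-! ### Finite differences of `x ↦ (x+1)^{-s}` -/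

def fdOp (g : ℝ → ℂ) : ℝ → ℂ := fun x => g (x + 1) - g x

noncomputable def gPow (s : ℂ) : ℝ → ℂ := fun x => ((x + 1 : ℝ) : ℂ) ^ (-s)

lemma fdOp_succ (k : ℕ) (g : ℝ → ℂ) (x : ℝ) :
    fdOp^[k + 1] g x = fdOp^[k] g (x + 1) - fdOp^[k] g x := by
  rw [Function.iterate_succ_apply']
  rfl

lemma fdOp_const_mul (k : ℕ) (c : ℂ) (g : ℝ → ℂ) (x : ℝ) :
    fdOp^[k] (fun y => c * g y) x = c * fdOp^[k] g x := by
  induction k generalizing x with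
  | zero => rfl
  | succ k ih => rw [fdOp_succ, fdOp_succ, ih, ih]; ring

lemma fdOp_hasDerivAt (k : ℕ) (g g' : ℝ → ℂ) (h : ∀ x, 0 ≤ x → HasDerivAt g (g' x) x)
    (x : ℝ) (hx : 0 ≤ x) : HasDerivAt (fdOp^[k] g) (fdOp^[k] g' x) x := by
  induction k generalizing x with
  | zero => exact h x hx
  | succ k ih =>
    rw [fdOp_succ, show fdOp^[k + 1] g = fun x => fdOp^[k] g (x + 1) - fdOp^[k] g x from
      funext (fdOp_succ k g)]
    exact ((ih (x + 1) (by linarith)).comp_add_const x 1).sub (ih x hx)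

lemma gPow_hasDerivAt (s : ℂ) (x : ℝ) (hx : 0 ≤ x) :
    HasDerivAt (gPow s) (-s * gPow (s + 1) x) x := by
  by_cases hs : s = 0
  · subst hs
    have : gPow 0 = fun _ => 1 := by funext x; simp [gPow]
    rw [this]
    simpa using hasDerivAt_const x (1 : ℂ)
  · have := (hasDerivAt_ofReal_cpow_const (x := x + 1) (by linarith) (neg_ne_zero.mpr hs))
    have h2 := this.comp_add_const x 1
    unfold gPow
    rw [show -(s + 1) = -s - 1 by ring]
    exact h2

lemma norm_gPow (s : ℂ) (x : ℝ) (hx : 0 ≤ x) : ‖gPow s x‖ = (x + 1) ^ (-s.re) := by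
  unfold gPow
  rw [Complex.norm_cpow_eq_rpow_re_of_pos (by linarith)]
  simp

lemma fdOp_gPow_decay (k : ℕ) : ∀ (s : ℂ) (R : ℝ), ‖s‖ ≤ R → 0 ≤ s.re + k → ∀ x : ℝ, 0 ≤ x →
    ‖fdOp^[k] (gPow s) x‖ ≤ (R + k) ^ k * (x + 1) ^ (-(s.re + k)) := by
  induction k with
  | zero =>
    intro s R hR _ x hx
    simp [norm_gPow s x hx]
  | succ k ih =>
    intro s R hR hs x hx
    have hR0 : 0 ≤ R := (norm_nonneg s).trans hR
    rw [fdOp_succ]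
    have hd : ∀ y ∈ Set.Icc x (x + 1), HasDerivWithinAt (fdOp^[k] (gPow s))
        (-s * fdOp^[k] (gPow (s + 1)) y) (Set.Icc x (x + 1)) y := by
      intro y hy
      have := fdOp_hasDerivAt k (gPow s) (fun y => -s * gPow (s + 1) y)
        (fun z hz => gPow_hasDerivAt s z hz) y (hx.trans hy.1)
      rw [fdOp_const_mul] at this
      exact this.hasDerivWithinAt
    have hb : ∀ y ∈ Set.Icc x (x + 1), ‖-s * fdOp^[k] (gPow (s + 1)) y‖ ≤
        (R + (k + 1 : ℕ)) ^ (k + 1) * (x + 1) ^ (-(s.re + (k + 1 : ℕ))) := by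
      intro y hy
      have hy0 : 0 ≤ y := hx.trans hy.1
      have h1 := ih (s + 1) (R + 1) ((norm_add_le _ _).trans (by simpa using hR))
        (by simp; push_cast at hs; linarith) y hy0
      rw [norm_mul, norm_neg]
      have h2 : (y + 1) ^ (-((s + 1).re + k)) ≤ (x + 1) ^ (-(s.re + (k + 1 : ℕ))) := by
        have e : -((s + 1).re + (k : ℝ)) = -(s.re + (k + 1 : ℕ)) := by simp; ring
        rw [e]
        exact Real.rpow_le_rpow_of_nonpos (by linarith) (by linarith [hy.1]) (by linarith)
      have h3 : (0 : ℝ) ≤ (x + 1) ^ (-(s.re + (k + 1 : ℕ))) := by positivity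
      calc ‖s‖ * ‖fdOp^[k] (gPow (s + 1)) y‖
          ≤ (R + (k + 1 : ℕ)) * ((R + 1 + k) ^ k * (x + 1) ^ (-(s.re + (k + 1 : ℕ)))) := by
            apply mul_le_mul _ (h1.trans _) (norm_nonneg _) (by positivity)
            · push_cast
              linarith [Nat.cast_nonneg (α := ℝ) k]
            · gcongr
        _ = _ := by push_cast; ring
    have := (convex_Icc x (x + 1)).norm_image_sub_le_of_norm_hasDerivWithin_le hd hb
      (Set.left_mem_Icc.mpr (by linarith)) (Set.right_mem_Icc.mpr (by linarith))
    simpa using this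

lemma fdOp_gPow_bound (k : ℕ) (s : ℂ) (R : ℝ) (hR : ‖s‖ ≤ R) (x : ℝ) (hx : 0 ≤ x) :
    ‖fdOp^[k] (gPow s) x‖ ≤ 2 ^ k * (x + 1 + k) ^ R := by
  have hR0 : 0 ≤ R := (norm_nonneg s).trans hR
  induction k generalizing x with
  | zero =>
    simp only [Function.iterate_zero, id, pow_zero, one_mul, Nat.cast_zero, add_zero]
    rw [norm_gPow s x hx]
    apply Real.rpow_le_rpow_of_exponent_le (by linarith)
    have := Complex.abs_re_le_norm s
    linarith [neg_le_abs s.re]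
  | succ k ih =>
    rw [fdOp_succ]
    have h1 := ih (x + 1) (by linarith)
    have h2 := ih x hx
    have h3 : (x + 1 + k) ^ R ≤ (x + 1 + (k + 1 : ℕ)) ^ R := by
      apply Real.rpow_le_rpow (by positivity) _ hR0
      push_cast; linarith
    have e : x + 1 + 1 + (k : ℝ) = x + 1 + (k + 1 : ℕ) := by push_cast; ring
    rw [e] at h1
    have h4 : (2 : ℝ) ^ k * (x + 1 + k) ^ R ≤ 2 ^ k * (x + 1 + (k + 1 : ℕ)) ^ R := by gcongr
    have := norm_sub_le (fdOp^[k] (gPow s) (x + 1)) (fdOp^[k] (gPow s) x)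
    rw [pow_succ]
    linarith

lemma fdOp_gPow_differentiable (k : ℕ) (x : ℝ) (hx : 0 ≤ x) :
    Differentiable ℂ (fun s => fdOp^[k] (gPow s) x) := by
  induction k generalizing x with
  | zero =>
    simp only [Function.iterate_zero, id, gPow]
    have : ((x + 1 : ℝ) : ℂ) ≠ 0 := by
      exact_mod_cast (by linarith : x + 1 ≠ 0)
    intro s
    exact (differentiable_id.neg s).const_cpow (Or.inl this)
  | succ k ih =>
    simp only [fdOp_succ]
    exact (ih (x + 1) (by linarith)).sub (ih x hx)

/-! ### The continuations -/

noncomputable def cTail (c : ℕ → ℕ → ℂ) (k : ℕ) (s : ℂ) : ℂ :=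
  ∑' n : ℕ, c k (n + 1) * fdOp^[k] (gPow s) n

noncomputable def cL (c : ℕ → ℕ → ℂ) (k : ℕ) (s : ℂ) : ℂ :=
  ∑ j ∈ Finset.range k, c (j + 1) 0 * fdOp^[j] (gPow s) 0 + cTail c k s

lemma fdOp_gPow_summable (c : ℕ → ℂ) (B : ℝ) (hc : ∀ n, ‖c n‖ ≤ B) (k : ℕ) (s : ℂ)
    (hs : 1 < s.re + k) : Summable (fun n : ℕ => c n * fdOp^[k] (gPow s) n) := by
  have hp : Summable (fun n : ℕ => B * ((‖s‖ + k) ^ k * (((n + 1 : ℕ) : ℝ) ^ (-(s.re + k))))) := by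
    refine Summable.mul_left _ (Summable.mul_left _ ?_)
    exact (summable_nat_add_iff 1).mpr (Real.summable_nat_rpow.mpr (by linarith))
  refine Summable.of_norm_bounded hp fun n => ?_
  rw [norm_mul]
  have hB : 0 ≤ B := (norm_nonneg _).trans (hc n)
  have := fdOp_gPow_decay k s ‖s‖ le_rfl (by linarith) n (Nat.cast_nonneg n)
  push_cast
  exact mul_le_mul (hc n) this (norm_nonneg _) hB

lemma cL_succ (c : ℕ → ℕ → ℂ) (M : ℝ)
    (hrel : ∀ k n, c k (n + 1) = c (k + 1) n - c (k + 1) (n + 1))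
    (hb : ∀ k n, ‖c k n‖ ≤ M ^ k) (k : ℕ) (s : ℂ) (hs : 1 < s.re + k) :
    cL c (k + 1) s = cL c k s := by
  unfold cL
  rw [Finset.sum_range_succ, add_assoc]
  congr 1
  unfold cTail
  have h1 := fdOp_gPow_summable (c (k + 1)) (M ^ (k + 1)) (hb (k + 1)) k s hs
  have h2 := fdOp_gPow_summable (fun n => c (k + 1) (n + 1)) (M ^ (k + 1))
    (fun n => hb (k + 1) (n + 1)) k s hs
  have h3 := (summable_nat_add_iff 1).mpr h1
  simp only [hrel k, sub_mul, fdOp_succ, mul_sub]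
  rw [h1.tsum_sub h2, h1.tsum_eq_zero_add]
  push_cast at h3 ⊢
  rw [h3.tsum_sub h2]
  ring

lemma cL_eq (c : ℕ → ℕ → ℂ) (M : ℝ)
    (hrel : ∀ k n, c k (n + 1) = c (k + 1) n - c (k + 1) (n + 1))
    (hb : ∀ k n, ‖c k n‖ ≤ M ^ k) (k m : ℕ) (hkm : k ≤ m) (s : ℂ) (hs : 1 < s.re + k) :
    cL c m s = cL c k s := by
  induction m, hkm using Nat.le_induction with
  | base => rfl
  | succ m hm ih =>
    rw [cL_succ c M hrel hb m s, ih]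
    have : (k : ℝ) ≤ m := by exact_mod_cast hm
    linarith

lemma cTerm_bound (c : ℕ → ℕ → ℂ) (M : ℝ)
    (hb : ∀ k n, ‖c k n‖ ≤ M ^ k) (k : ℕ) (R : ℝ) (hR : R + 2 ≤ k) (s : ℂ) (hs : ‖s‖ ≤ R)
    (n : ℕ) : ‖c k (n + 1) * fdOp^[k] (gPow s) n‖ ≤
      M ^ k * (R + k) ^ k * (((n + 1 : ℕ) : ℝ) ^ (-2 : ℝ)) := by
  have hre := Complex.abs_re_le_norm s
  have hre2 := neg_le_abs s.re
  have hR0 : 0 ≤ R := (norm_nonneg s).trans hs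
  have h1 := fdOp_gPow_decay k s R hs (by linarith) n (Nat.cast_nonneg n)
  have h2 : ((n : ℝ) + 1) ^ (-(s.re + k)) ≤ ((n + 1 : ℕ) : ℝ) ^ (-2 : ℝ) := by
    push_cast
    apply Real.rpow_le_rpow_of_exponent_le
    · linarith [Nat.cast_nonneg (α := ℝ) n]
    · linarith
  rw [norm_mul, mul_assoc]
  refine mul_le_mul (hb _ _) (h1.trans ?_) (norm_nonneg _) ((norm_nonneg _).trans (hb k 0))
  gcongr

lemma summable_sq : Summable (fun n : ℕ => (((n + 1 : ℕ) : ℝ) ^ (-2 : ℝ))) :=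
  (summable_nat_add_iff 1).mpr (Real.summable_nat_rpow.mpr (by norm_num))

lemma cL_differentiableOn (c : ℕ → ℕ → ℂ) (M : ℝ)
    (hb : ∀ k n, ‖c k n‖ ≤ M ^ k) (k : ℕ) (R : ℝ) (hR : R + 2 ≤ k) :
    DifferentiableOn ℂ (cL c k) (Metric.ball 0 R) := by
  unfold cL cTail
  refine DifferentiableOn.add ?_ ?_
  · refine DifferentiableOn.fun_sum fun j _ => ?_
    exact ((fdOp_gPow_differentiable j 0 le_rfl).const_mul _).differentiableOn
  · refine Complex.differentiableOn_tsum_of_summable_norm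
      (summable_sq.mul_left (M ^ k * (R + k) ^ k)) (fun n => ?_) Metric.isOpen_ball
      (fun n s hs => cTerm_bound c M hb k R hR s (by simpa using (Metric.mem_ball.mp hs).le) n)
    exact ((fdOp_gPow_differentiable k n (Nat.cast_nonneg n)).const_mul _).differentiableOn

lemma cL_bound (c : ℕ → ℕ → ℂ) (M : ℝ) (hM : 1 ≤ M)
    (hb : ∀ k n, ‖c k n‖ ≤ M ^ k) (k : ℕ) (s : ℂ) (hk : ‖s‖ + 2 ≤ k) (hk' : (k : ℝ) ≤ ‖s‖ + 3) :
    ‖cL c k s‖ ≤ (1 + ∑' n : ℕ, (((n + 1 : ℕ) : ℝ) ^ (-2 : ℝ))) *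
      (2 * M * (2 * ‖s‖ + 4)) ^ (2 * ‖s‖ + 4) := by
  set R := ‖s‖ with hRdef
  have hR0 : 0 ≤ R := norm_nonneg s
  set Q := 2 * R + 4 with hQ
  have hQ1 : 1 ≤ Q := by linarith
  have h2M : 1 ≤ 2 * M := by linarith
  have hB1 : 1 ≤ 2 * M * Q := by nlinarith
  have hA : ∀ j ∈ Finset.range k, ‖c (j + 1) 0 * fdOp^[j] (gPow s) 0‖ ≤ (2 * M) ^ k * Q ^ R := by
    intro j hj
    have hj' : j + 1 ≤ k := Finset.mem_range.mp hj
    have hj'' : (j : ℝ) + 1 ≤ k := by exact_mod_cast hj'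
    have h1 := fdOp_gPow_bound j s R le_rfl 0 le_rfl
    rw [norm_mul]
    have h3 : (0 + 1 + (j : ℝ)) ^ R ≤ Q ^ R := by
      apply Real.rpow_le_rpow (by positivity) _ hR0
      linarith
    calc _ ≤ M ^ (j + 1) * (2 ^ j * Q ^ R) := by
          refine mul_le_mul (hb _ _) (h1.trans ?_) (norm_nonneg _) (by positivity)
          gcongr
      _ ≤ M ^ k * (2 ^ k * Q ^ R) := by
          gcongr
          · norm_num
          · omega
      _ = _ := by rw [mul_pow]; ring
  have hA' : ‖∑ j ∈ Finset.range k, c (j + 1) 0 * fdOp^[j] (gPow s) 0‖ ≤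
      (2 * M * Q) ^ Q := by
    have h := norm_sum_le_of_le _ hA
    rw [Finset.sum_const, Finset.card_range, nsmul_eq_mul] at h
    refine h.trans ?_
    have h1 : (2 * M) ^ k ≤ (2 * M) ^ Q := by
      rw [← Real.rpow_natCast]
      exact Real.rpow_le_rpow_of_exponent_le h2M (by linarith)
    have h2 : (k : ℝ) * Q ^ R ≤ Q ^ Q := by
      calc (k : ℝ) * Q ^ R ≤ Q ^ (1 : ℝ) * Q ^ R := by
            rw [Real.rpow_one]; gcongr; linarith
        _ = Q ^ (1 + R) := by rw [Real.rpow_add (by linarith)]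
        _ ≤ Q ^ Q := Real.rpow_le_rpow_of_exponent_le hQ1 (by linarith)
    rw [Real.mul_rpow (by linarith) (by linarith)]
    calc (k : ℝ) * ((2 * M) ^ k * Q ^ R) = (2 * M) ^ k * (k * Q ^ R) := by ring
      _ ≤ _ := by gcongr
  have hT : ‖cTail c k s‖ ≤ (2 * M * Q) ^ Q * ∑' n : ℕ, (((n + 1 : ℕ) : ℝ) ^ (-2 : ℝ)) := by
    unfold cTail
    have h1 := tsum_of_norm_bounded ((summable_sq.mul_left (M ^ k * (R + k) ^ k)).hasSum)
      (fun n => cTerm_bound c M hb k R hk s le_rfl n)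
    rw [tsum_mul_left] at h1
    refine h1.trans ?_
    have hS : 0 ≤ ∑' n : ℕ, (((n + 1 : ℕ) : ℝ) ^ (-2 : ℝ)) :=
      tsum_nonneg fun n => by positivity
    refine mul_le_mul_of_nonneg_right ?_ hS
    rw [← mul_pow]
    calc (M * (R + k)) ^ k ≤ (2 * M * Q) ^ k := by
          gcongr <;> linarith
      _ = (2 * M * Q) ^ (k : ℝ) := (Real.rpow_natCast _ _).symm
      _ ≤ _ := Real.rpow_le_rpow_of_exponent_le hB1 (by linarith)
  unfold cL
  refine (norm_add_le _ _).trans ?_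
  linarith

lemma growth (A : ℝ) (hA : 1 ≤ A) (ε : ℝ) (hε : 0 < ε) : ∃ C : ℝ, 0 < C ∧ ∀ R : ℝ, 0 ≤ R →
    (A * (2 * R + 4)) ^ (2 * R + 4) ≤ C * Real.exp (R ^ (1 + ε)) := by
  have h1 : ∀ᶠ R : ℝ in Filter.atTop, 6 * (Real.log (6 * A) + Real.log R) ≤ R ^ ε := by
    have ha := (isLittleO_log_rpow_atTop hε).bound (show (0 : ℝ) < 1 / 12 by norm_num)
    have hb := (tendsto_rpow_atTop hε).eventually_ge_atTop (12 * Real.log (6 * A))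
    filter_upwards [ha, hb, Filter.eventually_ge_atTop 0] with R h1 h2 h3
    rw [Real.norm_eq_abs, Real.norm_of_nonneg (by positivity)] at h1
    linarith [le_abs_self (Real.log R)]
  obtain ⟨R0, hR0⟩ := Filter.eventually_atTop.mp h1
  set R1 := max R0 1 with hR1
  have hR1' : 1 ≤ R1 := le_max_right _ _
  have hge : ∀ R : ℝ, 0 ≤ R → 1 ≤ A * (2 * R + 4) := fun R hR => by nlinarith
  refine ⟨(A * (2 * R1 + 4)) ^ (2 * R1 + 4) + 1, by
    have := hge R1 (by linarith)
    positivity, fun R hR => ?_⟩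
  have hp1 : (0 : ℝ) ≤ (A * (2 * R1 + 4)) ^ (2 * R1 + 4) := by
    have := hge R1 (by linarith)
    positivity
  rcases le_total R R1 with h | h
  · have ha : (A * (2 * R + 4)) ^ (2 * R + 4) ≤ (A * (2 * R1 + 4)) ^ (2 * R1 + 4) := by
      calc _ ≤ (A * (2 * R + 4)) ^ (2 * R1 + 4) :=
            Real.rpow_le_rpow_of_exponent_le (hge R hR) (by linarith)
        _ ≤ _ := by
            apply Real.rpow_le_rpow (by linarith [hge R hR]) _ (by linarith)
            gcongr
    have hb : 1 ≤ Real.exp (R ^ (1 + ε)) := Real.one_le_exp (by positivity)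
    nlinarith
  · have hRpos : 1 ≤ R := hR1'.trans h
    have h2 := hR0 R ((le_max_left _ _).trans h)
    have h3 : (A * (2 * R + 4)) ^ (2 * R + 4) ≤ Real.exp (R ^ (1 + ε)) := by
      calc (A * (2 * R + 4)) ^ (2 * R + 4) ≤ (A * (2 * R + 4)) ^ (6 * R) :=
            Real.rpow_le_rpow_of_exponent_le (hge R hR) (by linarith)
        _ ≤ (6 * A * R) ^ (6 * R) := by
            apply Real.rpow_le_rpow (by linarith [hge R hR]) _ (by linarith)
            nlinarith
        _ = Real.exp (R * (6 * (Real.log (6 * A) + Real.log R))) := by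
            rw [Real.rpow_def_of_pos (by positivity), Real.log_mul (by positivity) (by positivity)]
            congr 1; ring
        _ ≤ Real.exp (R ^ (1 + ε)) := by
            rw [Real.rpow_add (by linarith), Real.rpow_one]
            gcongr
    nlinarith [Real.exp_pos (R ^ (1 + ε))]

/-- The Cantor Dirichlet series admits an entire continuation of order at
most `1`. -/
theorem cantor_entire_continuation :
    ∃ L : ℂ → ℂ, Differentiable ℂ L ∧
      (∀ s : ℂ, 1 < s.re → L s = cantorSeries s) ∧
      (∀ ε : ℝ, 0 < ε → ∃ C : ℝ, 0 < C ∧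
        ∀ z : ℂ, ‖L z‖ ≤ C * Real.exp (‖z‖ ^ (1 + ε))) := by
  obtain ⟨c, h0, hrel, hb⟩ := exists_coeffs
  have hre : ∀ s : ℂ, -‖s‖ ≤ s.re := fun s => by
    linarith [Complex.abs_re_le_norm s, neg_le_abs s.re]
  refine ⟨fun s => cL c (⌈‖s‖⌉₊ + 2) s, fun s => ?_, fun s hs => ?_, fun ε hε => ?_⟩
  · set K := ⌈‖s‖ + 1⌉₊ + 2 with hK
    have hK' : ‖s‖ + 1 + 2 ≤ K := by
      rw [hK]; push_cast; linarith [Nat.le_ceil (‖s‖ + 1)]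
    have hd := cL_differentiableOn c cM hb K (‖s‖ + 1) hK'
    have hmem : Metric.ball (0 : ℂ) (‖s‖ + 1) ∈ nhds s :=
      Metric.isOpen_ball.mem_nhds (by simp)
    refine (hd.differentiableAt hmem).congr_of_eventuallyEq ?_
    filter_upwards [hmem] with z hz
    have hz' : ‖z‖ ≤ ‖s‖ + 1 := by simpa using (Metric.mem_ball.mp hz).le
    refine (cL_eq c cM hrel hb _ K ?_ z ?_).symm
    · have := Nat.ceil_mono hz'
      omega
    · push_cast
      linarith [Nat.le_ceil ‖z‖, hre z]
  · beta_reduce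
    rw [cL_eq c cM hrel hb 0 _ (Nat.zero_le _) s (by simpa using hs)]
    unfold cL cTail cantorSeries
    simp only [Finset.range_zero, Finset.sum_empty, zero_add, Function.iterate_zero, id, h0, gPow]
    refine tsum_congr fun n => ?_
    push_cast
    rfl
  · obtain ⟨C, hC, hg⟩ := growth (2 * cM) (by linarith [one_le_cM]) ε hε
    have hS : 0 ≤ ∑' n : ℕ, (((n + 1 : ℕ) : ℝ) ^ (-2 : ℝ)) :=
      tsum_nonneg fun n => by positivity
    refine ⟨(1 + ∑' n : ℕ, (((n + 1 : ℕ) : ℝ) ^ (-2 : ℝ))) * C, by positivity, fun z => ?_⟩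
    refine (cL_bound c cM one_le_cM hb (⌈‖z‖⌉₊ + 2) z ?_ ?_).trans ?_
    · push_cast
      linarith [Nat.le_ceil ‖z‖]
    · push_cast
      linarith [Nat.ceil_lt_add_one (norm_nonneg z)]
    · have h := mul_le_mul_of_nonneg_left (hg ‖z‖ (norm_nonneg z))
        (by linarith : 0 ≤ 1 + ∑' n : ℕ, (((n + 1 : ℕ) : ℝ) ^ (-2 : ℝ)))
      rwa [← mul_assoc] at h
end
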